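/- arXiv:2410.06630 — 2 statements merged into one kernel-verified Lean document; each statement's English description precedes it below -/
import Mathlib

section
/- Let R be a commutative ring of characteristic p. The kernel of the natural surjection W₂(R)/p → R (projection to the first Witt coordinate) is a square-zero ideal, isomorphic as an R-module to F_*R/R, i.e. to R (with R acting through a ↦ a^p) modulo the image of the p-th power Frobenius; hence W₂(R)/p is a square-zero extension of R by F_*R/R. -/
open WittVector in
theorem aux_trunc_V (p : ℕ) [Fact p.Prime] {R : Type*} [CommRing R] (X : WittVector p R) :
    WittVector.truncate 2 (verschiebung X) = TruncatedWittVector.mk p ![0, X.coeff 0] := by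
  apply TruncatedWittVector.ext
  intro i
  rw [WittVector.coeff_truncate, TruncatedWittVector.coeff_mk]
  fin_cases i
  · exact verschiebung_coeff_zero X
  · exact verschiebung_coeff_succ X 0

theorem aux_eq_mk (p : ℕ) {R : Type*} [CommRing R] (w : TruncatedWittVector p 2 R)
    (h : w.coeff 0 = 0) : w = TruncatedWittVector.mk p ![0, w.coeff 1] := by
  apply TruncatedWittVector.ext
  intro i
  rw [TruncatedWittVector.coeff_mk]
  fin_cases i
  · exact h
  · rfl

open WittVector in
theorem aux_mk_eq (p : ℕ) [Fact p.Prime] {R : Type*} [CommRing R] (x : R) :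
    TruncatedWittVector.mk p ![0, x] =
      WittVector.truncate 2 (verschiebung (teichmuller p x)) := by
  rw [aux_trunc_V, teichmuller_coeff_zero]

open WittVector in
theorem aux_p_mul (p : ℕ) [Fact p.Prime] {R : Type*} [CommRing R] [CharP R p]
    (Z : WittVector p R) :
    (p : TruncatedWittVector p 2 R) * WittVector.truncate 2 Z =
      TruncatedWittVector.mk p ![0, Z.coeff 0 ^ p] := by
  rw [← coeff_frobenius_charP, ← aux_trunc_V, verschiebung_frobenius, map_mul, map_natCast,
    mul_comm]

open WittVector in
/-- Let `R` be a commutative ring of characteristic `p`.  The kernel of the natural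
surjection `W₂(R)/p → R` (projection to the first Witt coordinate) is a square-zero ideal,
isomorphic as an `R`-module to `F_*R/R`: the map `g` sending `x ∈ R` to (the class mod `p`
of) the Witt vector `(0, x)` lands in the kernel, is additive mod `p`, is `R`-semilinear
(for the Frobenius-twisted action `a·x = a^p x`, corresponding to multiplication by the
Teichmüller lift `[a]`), is surjective onto the kernel mod `p`, and its kernel mod `p` is
exactly the image of the Frobenius `x ↦ x^p`.  Hence `W₂(R)/p` is a square-zero extension
of `R` by `F_*R/R`. -/
theorem stmt6 (p : ℕ) [Fact p.Prime] (R : Type*) [CommRing R] [CharP R p] :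
    (∀ x y : TruncatedWittVector p 2 R, x.coeff 0 = 0 → y.coeff 0 = 0 →
        ∃ z, x * y = (p : TruncatedWittVector p 2 R) * z) ∧
    ∃ g : R → TruncatedWittVector p 2 R,
      (∀ x : R, g x = TruncatedWittVector.mk p ![0, x]) ∧
      (∀ x : R, (g x).coeff 0 = 0) ∧
      (∀ x y : R, ∃ z, g (x + y) - g x - g y = (p : TruncatedWittVector p 2 R) * z) ∧
      (∀ (a x : R), ∃ z,
        g (a ^ p * x) -
            WittVector.truncate 2 (WittVector.teichmuller p a) * g x =
          (p : TruncatedWittVector p 2 R) * z) ∧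
      (∀ w : TruncatedWittVector p 2 R, w.coeff 0 = 0 →
        ∃ (r : R) (z : TruncatedWittVector p 2 R),
          w = g r + (p : TruncatedWittVector p 2 R) * z) ∧
      (∀ r : R, (∃ z, g r = (p : TruncatedWittVector p 2 R) * z) ↔ ∃ s : R, r = s ^ p) := by
  refine ⟨?_, fun x => TruncatedWittVector.mk p ![0, x], fun _ => rfl, ?_, ?_, ?_, ?_, ?_⟩
  · intro x y hx hy
    refine ⟨0, ?_⟩
    rw [aux_eq_mk p x hx, aux_eq_mk p y hy, aux_mk_eq, aux_mk_eq, ← map_mul,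
      ← verschiebung_mul_frobenius, frobenius_verschiebung, aux_trunc_V, ← mul_assoc,
      mul_charP_coeff_zero, mul_zero]
    have := aux_trunc_V p (0 : WittVector p R)
    rw [map_zero, map_zero, zero_coeff] at this
    exact this.symm
  · intro x
    rw [TruncatedWittVector.coeff_mk]
    rfl
  · intro x y
    refine ⟨0, ?_⟩
    have := aux_trunc_V p (teichmuller p x + teichmuller p y)
    rw [add_coeff_zero, teichmuller_coeff_zero, teichmuller_coeff_zero, map_add, map_add,
      ← aux_mk_eq, ← aux_mk_eq] at this
    simp only [← this]
    ring
  · intro a x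
    refine ⟨0, ?_⟩
    simp only [aux_mk_eq p x]
    rw [← map_mul, mul_comm (teichmuller p a), ← verschiebung_mul_frobenius, aux_trunc_V,
      mul_coeff_zero, coeff_frobenius_charP, teichmuller_coeff_zero, teichmuller_coeff_zero,
      mul_comm x, sub_self, mul_zero]
  · intro w hw
    exact ⟨w.coeff 1, 0, by rw [mul_zero, add_zero]; exact aux_eq_mk p w hw⟩
  · intro r
    constructor
    · rintro ⟨z, hz⟩
      obtain ⟨Z, rfl⟩ := WittVector.truncate_surjective p 2 R z
      rw [aux_p_mul] at hz
      refine ⟨Z.coeff 0, ?_⟩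
      have := congrArg (fun w => TruncatedWittVector.coeff 1 w) hz
      simpa [TruncatedWittVector.coeff_mk] using this
    · rintro ⟨s, rfl⟩
      refine ⟨WittVector.truncate 2 (teichmuller p s), ?_⟩
      rw [aux_p_mul, teichmuller_coeff_zero]
end

section
/- Let R be a commutative ring of characteristic p. For any a, b ∈ R, one has [a+b]^p - [a]^p - [b]^p ∈ p·W(R), where [·] denotes the Teichmüller lift in W(R). Consequently, the formula a·x := [a]^p · x defines an R-module structure on the abelian group W(R)/F(W(R)). -/
theorem frob_teich (p : ℕ) [Fact p.Prime] (R : Type*) [CommRing R] [CharP R p] (a : R) :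
    WittVector.frobenius (WittVector.teichmuller p a) = (WittVector.teichmuller p a) ^ p := by
  rw [WittVector.frobenius_eq_map_frobenius, WittVector.map_teichmuller, frobenius_def, map_pow]

theorem exists_ver (p : ℕ) [Fact p.Prime] (R : Type*) [CommRing R] (d : WittVector p R)
    (h : d.coeff 0 = 0) : ∃ y, WittVector.verschiebung y = d := by
  refine ⟨WittVector.mk p fun n => d.coeff (n + 1), ?_⟩
  ext n
  cases n with
  | zero => rw [WittVector.verschiebung_coeff_zero, h]
  | succ n => rw [WittVector.verschiebung_coeff_add_one]; rfl

/-- Let `R` be a commutative ring of characteristic `p`.  For any `a, b ∈ R`, one has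
`[a+b]^p - [a]^p - [b]^p ∈ p·W(R)` for the Teichmüller lifts.  Consequently the formula
`a·x := [a]^p·x` defines an `R`-module structure on the abelian group `W(R)/F(W(R))`:
the action is additive in `a` modulo `F(W(R))` (as `p·W(R) ⊆ F(W(R))`), and multiplication
by `[a]^p` preserves the subgroup `F(W(R))`. -/
theorem stmt8 (p : ℕ) [Fact p.Prime] (R : Type*) [CommRing R] [CharP R p] :
    (∀ a b : R, ∃ y : WittVector p R,
      (WittVector.teichmuller p (a + b)) ^ p - (WittVector.teichmuller p a) ^ p -
          (WittVector.teichmuller p b) ^ p = (p : WittVector p R) * y) ∧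
    (∀ (a b : R) (x : WittVector p R), ∃ w : WittVector p R,
      (WittVector.teichmuller p (a + b)) ^ p * x - (WittVector.teichmuller p a) ^ p * x -
          (WittVector.teichmuller p b) ^ p * x = WittVector.frobenius w) ∧
    (∀ (a : R) (w : WittVector p R), ∃ u : WittVector p R,
      (WittVector.teichmuller p a) ^ p * WittVector.frobenius w =
        WittVector.frobenius u) := by
  have key : ∀ a b : R, ∃ y : WittVector p R,
      (WittVector.teichmuller p (a + b)) ^ p - (WittVector.teichmuller p a) ^ p -
          (WittVector.teichmuller p b) ^ p = (p : WittVector p R) * y := by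
    intro a b
    obtain ⟨y, hy⟩ := exists_ver p R (WittVector.teichmuller p (a + b) -
      WittVector.teichmuller p a - WittVector.teichmuller p b) (by
        change WittVector.constantCoeff (WittVector.teichmuller p (a + b) -
          WittVector.teichmuller p a - WittVector.teichmuller p b) = 0
        rw [map_sub, map_sub]
        change (WittVector.teichmuller p (a + b)).coeff 0 - (WittVector.teichmuller p a).coeff 0
          - (WittVector.teichmuller p b).coeff 0 = 0
        simp only [WittVector.teichmuller_coeff_zero]
        ring)
    refine ⟨y, ?_⟩
    rw [← frob_teich, ← frob_teich, ← frob_teich, ← map_sub, ← map_sub, ← hy,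
      WittVector.frobenius_verschiebung, mul_comm]
  refine ⟨key, ?_, ?_⟩
  · intro a b x
    obtain ⟨y, hy⟩ := key a b
    refine ⟨WittVector.verschiebung (y * x), ?_⟩
    rw [WittVector.frobenius_verschiebung, ← sub_mul, ← sub_mul, hy]
    ring
  · intro a w
    exact ⟨WittVector.teichmuller p a * w, by rw [map_mul, frob_teich]⟩
end
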